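/- Let Θ be a suitable set of moduli of continuity and let E be a set of weak Θ-Carathéodory functions f : ℝ × ℝ^N → ℝ^M admitting L¹_loc-equicontinuous m-bounds. If (f_n) is a sequence in E converging in the σ_Θ sense to a weak Θ-Carathéodory function f, and (t_n) is a sequence of reals converging to t ∈ ℝ, then the translates (f_n)_{t_n}, defined by (f_n)_{t_n}(s,x) := f_n(s + t_n, x), converge in the σ_Θ sense to the translate f_t. In other words, the translation map (t, f) ↦ f_t is jointly sequentially continuous on ℝ × E for the σ_Θ convergence. -/

import Mathlib

open MeasureTheory Set Filter Topology
open scoped RealInnerProductSpace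

noncomputable section

abbrev Euc (n : ℕ) := EuclideanSpace ℝ (Fin n)

/-- A function `ℝ → ℝ` is locally integrable (w.r.t. Lebesgue measure) on every
compact interval. -/
def LocInt (m : ℝ → ℝ) : Prop := ∀ a b : ℝ, IntegrableOn m (Icc a b)

section Defs

variable {N : ℕ} {F : Type*} [NormedAddCommGroup F] [NormedSpace ℝ F]

/-- The Carathéodory conditions (C1) and (C2). -/
def IsCara (f : ℝ → Euc N → F) : Prop :=
  StronglyMeasurable (Function.uncurry f) ∧
  ∀ K : Set (Euc N), IsCompact K → ∃ m : ℝ → ℝ, (∀ t, 0 ≤ m t) ∧ LocInt m ∧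
    ∀ᵐ t : ℝ, ∀ x ∈ K, ‖f t x‖ ≤ m t

/-- A suitable set of moduli of continuity `Θ = {θ_j^{[q₁,q₂]}}`. -/
structure SuitableModuli where
  θ : ℕ → ℚ → ℚ → ℝ → ℝ
  nonneg : ∀ j q₁ q₂ s, (0:ℝ) ≤ s → 0 ≤ θ j q₁ q₂ s
  cont : ∀ j q₁ q₂, ContinuousOn (θ j q₁ q₂) (Ici 0)
  mono : ∀ j q₁ q₂, MonotoneOn (θ j q₁ q₂) (Ici 0)
  zero : ∀ j q₁ q₂, θ j q₁ q₂ 0 = 0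
  ordered : ∀ j₁ j₂ q₁ q₂ p₁ p₂, j₁ ≤ j₂ → p₁ ≤ q₁ → q₂ ≤ p₂ →
    ∀ s : ℝ, 0 ≤ s → θ j₁ q₁ q₂ s ≤ θ j₂ p₁ p₂ s

/-- `x ∈ K_j^{[q₁,q₂]}`: continuous, bounded by `j` and with modulus of continuity
`θ_j^{[q₁,q₂]}` on `[q₁,q₂]`. -/
def inK {N : ℕ} (Θ : SuitableModuli) (j : ℕ) (q₁ q₂ : ℚ) (x : ℝ → Euc N) : Prop :=
  ContinuousOn x (Icc (q₁:ℝ) (q₂:ℝ)) ∧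
  (∀ t ∈ Icc (q₁:ℝ) (q₂:ℝ), ‖x t‖ ≤ (j:ℝ)) ∧
  ∀ t ∈ Icc (q₁:ℝ) (q₂:ℝ), ∀ s ∈ Icc (q₁:ℝ) (q₂:ℝ), ‖x t - x s‖ ≤ Θ.θ j q₁ q₂ |t - s|

/-- Weak Θ-Carathéodory functions: Carathéodory conditions plus condition (W). -/
def IsWTC (Θ : SuitableModuli) (f : ℝ → Euc N → F) : Prop :=
  IsCara f ∧
  ∀ (j : ℕ) (q₁ q₂ : ℚ) (xs : ℕ → ℝ → Euc N) (x : ℝ → Euc N),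
    (∀ n, inK Θ j q₁ q₂ (xs n)) → inK Θ j q₁ q₂ x →
    TendstoUniformlyOn (fun n t => xs n t) x atTop (Icc (q₁:ℝ) (q₂:ℝ)) →
    Tendsto (fun n => ∫ t in Icc (q₁:ℝ) (q₂:ℝ), f t (xs n t)) atTop
      (𝓝 (∫ t in Icc (q₁:ℝ) (q₂:ℝ), f t (x t)))

/-- Convergence in the `σ_Θ` sense:
`sup_{x ∈ K_j^I} ‖∫_I (f_n(t,x(t)) − f(t,x(t))) dt‖ → 0` for every `j` and `I`. -/
def SigmaTendsto (Θ : SuitableModuli) (fs : ℕ → ℝ → Euc N → F) (f : ℝ → Euc N → F) : Prop :=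
  ∀ (j : ℕ) (q₁ q₂ : ℚ), ∀ ε > (0:ℝ), ∀ᶠ n in atTop, ∀ x : ℝ → Euc N, inK Θ j q₁ q₂ x →
    ‖∫ t in Icc (q₁:ℝ) (q₂:ℝ), (fs n t (x t) - f t (x t))‖ < ε

end Defs

/-- Lipschitz Carathéodory functions. -/
def IsLC {N : ℕ} (f : ℝ → Euc N → Euc N) : Prop :=
  IsCara f ∧
  ∀ K : Set (Euc N), IsCompact K → ∃ l : ℝ → ℝ, LocInt l ∧
    ∀ᵐ t : ℝ, ∀ x ∈ K, ∀ y ∈ K, ‖f t x - f t y‖ ≤ l t * ‖x - y‖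

/-- The optimal m-bound of `f` on the closed ball `B_j`. -/
def mOpt {N : ℕ} (f : ℝ → Euc N → Euc N) (j : ℕ) (t : ℝ) : ℝ :=
  sSup {v : ℝ | ∃ x : Euc N, ‖x‖ ≤ (j:ℝ) ∧ v = ‖f t x‖}

/-- The time translation `f_r(s,x) = f(s+r,x)`. -/
def timeTranslate {N : ℕ} (f : ℝ → Euc N → Euc N) (r : ℝ) : ℝ → Euc N → Euc N :=
  fun s x => f (s + r) x

/-- `x` is a solution of `ẋ = g(t,x)`, `x(0) = x₀`, defined on `[0,∞)`. -/
def IsSolOn {N : ℕ} (g : ℝ → Euc N → Euc N) (x₀ : Euc N) (x : ℝ → Euc N) : Prop :=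
  ContinuousOn x (Ici 0) ∧ ∀ t ∈ Ici (0:ℝ), x t = x₀ + ∫ s in (0:ℝ)..t, g s (x s)

section Aux

variable {N : ℕ} {F : Type*} [NormedAddCommGroup F]

theorem LocInt.intervalIntegrable {m : ℝ → ℝ} (hm : LocInt m) (a b : ℝ) :
    IntervalIntegrable m volume a b := by
  rw [intervalIntegrable_iff]
  exact (hm (min a b) (max a b)).mono_set Ioc_subset_Icc_self

theorem IsCara.exists_bound_ball {f : ℝ → Euc N → F} (hf : IsCara f) (j : ℕ) :
    ∃ m : ℝ → ℝ, LocInt m ∧ ∀ᵐ t : ℝ, ∀ x : Euc N, ‖x‖ ≤ (j : ℝ) → ‖f t x‖ ≤ m t := by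
  obtain ⟨m, -, hm, hb⟩ := hf.2 (Metric.closedBall 0 j) (isCompact_closedBall 0 _)
  exact ⟨m, hm, hb.mono fun t ht x hx => ht x (by simpa using hx)⟩

theorem intervalIntegrable_comp_of_bound {g : ℝ → Euc N → F} {m : ℝ → ℝ} {y : ℝ → Euc N} {j : ℕ}
    (hg : StronglyMeasurable (Function.uncurry g)) (hm : LocInt m)
    (hb : ∀ᵐ t : ℝ, ∀ x : Euc N, ‖x‖ ≤ (j : ℝ) → ‖g t x‖ ≤ m t)
    (hy : Continuous y) (hyj : ∀ u, ‖y u‖ ≤ (j : ℝ)) (a b : ℝ) :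
    IntervalIntegrable (fun u => g u (y u)) volume a b := by
  refine (hm.intervalIntegrable a b).mono_fun'
    (hg.comp_measurable (measurable_id.prodMk hy.measurable)).aestronglyMeasurable ?_
  exact ae_restrict_of_ae (hb.mono fun u hu => hu _ (hyj u))

variable [NormedSpace ℝ F]

theorem norm_integral_comp_le_of_bound {g : ℝ → Euc N → F} {m : ℝ → ℝ} {y : ℝ → Euc N} {j : ℕ}
    (hm : LocInt m) (hb : ∀ᵐ t : ℝ, ∀ x : Euc N, ‖x‖ ≤ (j : ℝ) → ‖g t x‖ ≤ m t)
    (hyj : ∀ u, ‖y u‖ ≤ (j : ℝ)) (a b : ℝ) :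
    ‖∫ u in a..b, g u (y u)‖ ≤ |∫ u in a..b, m u| :=
  intervalIntegral.norm_integral_le_abs_of_norm_le
    (ae_restrict_of_ae (hb.mono fun u hu => hu _ (hyj u))) (hm.intervalIntegrable a b)

/-- On the compact set `K_j^I`, condition (W) self-improves to uniform continuity. -/
theorem IsWTC.uniform {Θ : SuitableModuli} {f : ℝ → Euc N → F} (hf : IsWTC Θ f) (j : ℕ)
    {p₁ p₂ : ℚ} (hp : (p₁ : ℝ) ≤ p₂) {ε : ℝ} (hε : 0 < ε) :
    ∃ δ > (0 : ℝ), ∀ x y : ℝ → Euc N, inK Θ j p₁ p₂ x → inK Θ j p₁ p₂ y →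
      (∀ u ∈ Icc (p₁ : ℝ) p₂, ‖x u - y u‖ < δ) →
      ‖(∫ t in Icc (p₁ : ℝ) p₂, f t (x t)) - ∫ t in Icc (p₁ : ℝ) p₂, f t (y t)‖ < ε := by
  let B := BoundedContinuousFunction (Icc (p₁ : ℝ) p₂) (Euc N)
  let S : Set B := {g | (∀ t, ‖g t‖ ≤ (j : ℝ)) ∧
    ∀ t s, ‖g t - g s‖ ≤ Θ.θ j p₁ p₂ |(t : ℝ) - s|}
  have hθ : Tendsto (Θ.θ j p₁ p₂) (𝓝[Ici 0] 0) (𝓝 0) := by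
    have := Θ.cont j p₁ p₂ 0 self_mem_Ici
    rwa [ContinuousWithinAt, Θ.zero] at this
  have hcomp : IsCompact S := by
    refine BoundedContinuousFunction.arzela_ascoli₂ (Metric.closedBall 0 j)
      (isCompact_closedBall 0 _) S ?_ (fun g x hg => by simpa using hg.1 x) ?_
    · have hev : ∀ t, Continuous fun g : B => g t :=
        fun t => continuous_eval_const t
      simp only [S, ofPred_and, ofPred_forall]
      refine IsClosed.inter (isClosed_iInter fun t => ?_)
        (isClosed_iInter fun t => isClosed_iInter fun s => ?_)
      · exact isClosed_le (hev t).norm continuous_const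
      · exact isClosed_le ((hev t).sub (hev s)).norm continuous_const
    · refine Metric.equicontinuous_of_continuity_modulus
        (fun r => Θ.θ j p₁ p₂ |r|) ?_ _ ?_
      · refine hθ.comp (tendsto_nhdsWithin_iff.2 ⟨?_, Eventually.of_forall fun r => mem_Ici.2 (abs_nonneg r)⟩)
        simpa using (continuous_abs (G := ℝ)).tendsto 0
      · intro t s g
        rw [dist_eq_norm, abs_of_nonneg dist_nonneg, Subtype.dist_eq, Real.dist_eq]
        exact g.2.2 t s
  let Φ : S → F := fun g => ∫ t in Icc (p₁ : ℝ) p₂, f t (g.1 (projIcc (p₁ : ℝ) p₂ hp t))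
  have hK : ∀ g : S, inK Θ j p₁ p₂ fun t => g.1 (projIcc (p₁ : ℝ) p₂ hp t) := by
    intro g
    refine ⟨(g.1.continuous.comp continuous_projIcc).continuousOn, fun t _ => g.2.1 _, ?_⟩
    intro t ht s hs
    have := g.2.2 (projIcc (p₁ : ℝ) p₂ hp t) (projIcc (p₁ : ℝ) p₂ hp s)
    simpa only [projIcc_of_mem hp ht, projIcc_of_mem hp hs] using this
  have hΦ : Continuous Φ := by
    rw [continuous_iff_seqContinuous]
    intro gs g hg
    refine hf.2 j p₁ p₂ _ _ (fun n => hK (gs n)) (hK g) ?_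
    have h1 : Tendsto (fun n => (gs n).1) atTop (𝓝 g.1) := (continuous_subtype_val.tendsto g).comp hg
    rw [BoundedContinuousFunction.tendsto_iff_tendstoUniformly] at h1
    exact (h1.comp (projIcc (p₁ : ℝ) p₂ hp)).tendstoUniformlyOn
  have : CompactSpace S := isCompact_iff_compactSpace.1 hcomp
  obtain ⟨δ, hδ, h⟩ := Metric.uniformContinuous_iff.1
    (CompactSpace.uniformContinuous_of_continuous hΦ) ε hε
  have lift : ∀ x : ℝ → Euc N, inK Θ j p₁ p₂ x → ∃ g : S, ∀ t, g.1 t = x t := fun x hx =>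
    ⟨⟨BoundedContinuousFunction.mkOfCompact ⟨_, hx.1.domRestrict⟩,
      fun t => hx.2.1 t t.2, fun t s => hx.2.2 t t.2 s s.2⟩, fun t => rfl⟩
  have hΦx : ∀ (x : ℝ → Euc N) (g : S), (∀ t, g.1 t = x t) →
      Φ g = ∫ t in Icc (p₁ : ℝ) p₂, f t (x t) := by
    intro x g hg
    refine setIntegral_congr_fun measurableSet_Icc fun t ht => ?_
    simp only [hg, projIcc_of_mem hp ht]
  refine ⟨δ / 2, half_pos hδ, fun x y hx hy hxy => ?_⟩
  obtain ⟨gx, hgx⟩ := lift x hx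
  obtain ⟨gy, hgy⟩ := lift y hy
  rw [← hΦx x gx hgx, ← hΦx y gy hgy, ← dist_eq_norm]
  refine h (lt_of_le_of_lt ?_ (half_lt_self hδ))
  rw [Subtype.dist_eq, BoundedContinuousFunction.dist_le (half_pos hδ).le]
  intro t
  rw [hgx, hgy, dist_eq_norm]
  exact (hxy t t.2).le

theorem inK_const (Θ : SuitableModuli) {j : ℕ} (q₁ q₂ : ℚ) {c : Euc N} (hc : ‖c‖ ≤ (j : ℝ)) :
    inK Θ j q₁ q₂ fun _ => c :=
  ⟨continuousOn_const, fun _ _ => hc, fun t _ s _ => by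
    simpa using Θ.nonneg j q₁ q₂ _ (abs_nonneg (t - s))⟩

/-- A curve in `K_j^I`, extended by constants to the real line. -/
theorem inK.exists_extension {Θ : SuitableModuli} {j : ℕ} {q₁ q₂ : ℚ} {x : ℝ → Euc N}
    (hx : inK Θ j q₁ q₂ x) (hq : (q₁ : ℝ) ≤ q₂) :
    ∃ X : ℝ → Euc N, Continuous X ∧ (∀ u, ‖X u‖ ≤ (j : ℝ)) ∧
      (∀ u v, ‖X u - X v‖ ≤ Θ.θ j q₁ q₂ |u - v|) ∧ (∀ u ∈ Icc (q₁ : ℝ) q₂, X u = x u) ∧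
      (∀ u ≤ (q₁ : ℝ), X u = x q₁) ∧ ∀ u, (q₂ : ℝ) ≤ u → X u = x q₂ := by
  refine ⟨fun u => x (projIcc (q₁ : ℝ) q₂ hq u), hx.1.domRestrict.comp continuous_projIcc,
    fun u => hx.2.1 _ (projIcc _ _ hq u).2, fun u v => ?_, fun u hu => ?_, fun u hu => ?_,
    fun u hu => ?_⟩
  · refine (hx.2.2 _ (projIcc _ _ hq u).2 _ (projIcc _ _ hq v).2).trans
      (Θ.mono j q₁ q₂ (mem_Ici.2 (abs_nonneg _)) (mem_Ici.2 (abs_nonneg _)) (abs_projIcc_sub_projIcc hq))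
  · simp only [projIcc_of_mem hq hu]
  · simp only [projIcc_of_le_left hq hu]
  · simp only [projIcc_of_right_le hq hu]

theorem inK_of_forall {Θ : SuitableModuli} {j : ℕ} {q₁ q₂ p₁ p₂ : ℚ} {X : ℝ → Euc N}
    (hX : Continuous X) (hXj : ∀ u, ‖X u‖ ≤ (j : ℝ))
    (hXθ : ∀ u v, ‖X u - X v‖ ≤ Θ.θ j q₁ q₂ |u - v|) (h₁ : p₁ ≤ q₁) (h₂ : q₂ ≤ p₂) (r : ℝ) :
    inK Θ j p₁ p₂ fun u => X (u - r) := by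
  refine ⟨(hX.comp (continuous_sub_right r)).continuousOn, fun u _ => hXj _, fun u _ v _ => ?_⟩
  have := hXθ (u - r) (v - r)
  rw [sub_sub_sub_cancel_right] at this
  exact this.trans (Θ.ordered j j q₁ q₂ p₁ p₂ le_rfl h₁ h₂ _ (abs_nonneg _))

theorem setIntegral_Icc_eq_intervalIntegral (g : ℝ → F) {a b : ℝ} (h : a ≤ b) :
    ∫ t in Icc a b, g t = ∫ t in a..b, g t := by
  rw [intervalIntegral.integral_of_le h, integral_Icc_eq_integral_Ioc]

theorem SigmaTendsto.intervalIntegral_const {Θ : SuitableModuli} {fs : ℕ → ℝ → Euc N → F}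
    {f : ℝ → Euc N → F} (h : SigmaTendsto Θ fs f) (j : ℕ) (p a : ℚ) {ε : ℝ} (hε : 0 < ε) :
    ∀ᶠ n in atTop, ∀ c : Euc N, ‖c‖ ≤ (j : ℝ) →
      ‖∫ u in (p : ℝ)..a, (fs n u c - f u c)‖ < ε := by
  rcases le_total (p : ℝ) a with hpa | hpa
  · filter_upwards [h j p a ε hε] with n hn c hc
    rw [← setIntegral_Icc_eq_intervalIntegral _ hpa]
    exact hn _ (inK_const Θ p a hc)
  · filter_upwards [h j a p ε hε] with n hn c hc
    rw [intervalIntegral.integral_symm, norm_neg, ← setIntegral_Icc_eq_intervalIntegral _ hpa]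
    exact hn _ (inK_const Θ a p hc)

/-- `σ_Θ` convergence controls integrals at constant states over intervals whose second endpoint
is a real number that is allowed to move. -/
theorem SigmaTendsto.intervalIntegral_const_moving {Θ : SuitableModuli}
    {fs : ℕ → ℝ → Euc N → F} {f : ℝ → Euc N → F} (h : SigmaTendsto Θ fs f)
    (hf : IsCara f) (hfs : ∀ n, StronglyMeasurable (Function.uncurry (fs n))) (j : ℕ)
    {m : ℕ → ℝ → ℝ} (hm_nonneg : ∀ n t, 0 ≤ m n t) (hm : ∀ n, LocInt (m n))
    (hb : ∀ n, ∀ᵐ t : ℝ, ∀ x : Euc N, ‖x‖ ≤ (j : ℝ) → ‖fs n t x‖ ≤ m n t)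
    (heq : ∀ r > (0 : ℝ), ∀ ε > (0 : ℝ), ∃ δ > (0 : ℝ), ∀ n, ∀ s t : ℝ,
      -r ≤ s → s ≤ t → t ≤ r → t - s < δ → ∫ u in Icc s t, m n u < ε)
    (p : ℚ) {a : ℝ} {as : ℕ → ℝ} (has : Tendsto as atTop (𝓝 a)) {ε : ℝ} (hε : 0 < ε) :
    ∀ᶠ n in atTop, ∀ c : Euc N, ‖c‖ ≤ (j : ℝ) →
      ‖(∫ u in (p : ℝ)..as n, fs n u c) - ∫ u in (p : ℝ)..a, f u c‖ < ε := by
  obtain ⟨μ, hμ, hμb⟩ := hf.exists_bound_ball j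
  have hε3 : 0 < ε / 3 := by positivity
  obtain ⟨δ, hδ, hδm⟩ := heq (|a| + 1) (by positivity) (ε / 3) hε3
  have hprim : Tendsto (fun b => |∫ u in a..b, μ u|) (𝓝 a) (𝓝 0) := by
    have := (intervalIntegral.continuous_primitive hμ.intervalIntegrable a).abs.tendsto a
    simpa using this
  obtain ⟨η, hη, hημ⟩ := Metric.eventually_nhds_iff.1 (hprim.eventually_lt_const hε3)
  obtain ⟨b, hb1, hb2⟩ := exists_rat_btwn
    (show a < a + min (min η (δ / 2)) 1 by
      have : 0 < min (min η (δ / 2)) 1 := by positivity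
      linarith)
  have hbη : (b : ℝ) < a + η := hb2.trans_le (by gcongr; exact (min_le_left _ _).trans (min_le_left _ _))
  have hbδ : (b : ℝ) < a + δ / 2 :=
    hb2.trans_le (by gcongr; exact (min_le_left _ _).trans (min_le_right _ _))
  have hb1' : (b : ℝ) < a + 1 := hb2.trans_le (by gcongr; exact min_le_right _ _)
  have hclose : ∀ᶠ n in atTop, |as n - a| < min (δ / 2) 1 :=
    Metric.tendsto_nhds.1 has _ (by positivity)
  filter_upwards [h.intervalIntegral_const j p b hε3, hclose] with n hn hcn c hc
  have hI : ∀ s t : ℝ, IntervalIntegrable (fun u => fs n u c) volume s t :=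
    intervalIntegrable_comp_of_bound (y := fun _ => c) (hfs n) (hm n) (hb n) continuous_const
      (fun _ => hc)
  have hJ : ∀ s t : ℝ, IntervalIntegrable (fun u => f u c) volume s t :=
    intervalIntegrable_comp_of_bound (y := fun _ => c) hf.1 hμ hμb continuous_const
      (fun _ => hc)
  have hsplit : (∫ u in (p : ℝ)..as n, fs n u c) - ∫ u in (p : ℝ)..a, f u c =
      (∫ u in (p : ℝ)..b, (fs n u c - f u c)) + (∫ u in (b : ℝ)..as n, fs n u c) +
        ∫ u in a..b, f u c := by
    rw [intervalIntegral.integral_sub (hI _ _) (hJ _ _),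
      ← intervalIntegral.integral_add_adjacent_intervals (hI p b) (hI b (as n)),
      ← intervalIntegral.integral_add_adjacent_intervals (hJ p a) (hJ a b)]
    abel
  have h1 := hn c hc
  have h2 : ‖∫ u in (b : ℝ)..as n, fs n u c‖ < ε / 3 := by
    refine (norm_integral_comp_le_of_bound (y := fun _ => c) (hm n) (hb n) (fun _ => hc)
      _ _).trans_lt ?_
    have hlt := abs_lt.1 (hcn.trans_le (min_le_left _ _))
    have hlt1 := abs_lt.1 (hcn.trans_le (min_le_right _ _))
    have ha1 := neg_abs_le a
    have ha2 := le_abs_self a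
    rcases le_total (b : ℝ) (as n) with hba | hba
    · rw [← setIntegral_Icc_eq_intervalIntegral _ hba,
        abs_of_nonneg (integral_nonneg fun u => hm_nonneg n u)]
      exact hδm n _ _ (by linarith) hba (by linarith) (by linarith)
    · rw [intervalIntegral.integral_symm, abs_neg, ← setIntegral_Icc_eq_intervalIntegral _ hba,
        abs_of_nonneg (integral_nonneg fun u => hm_nonneg n u)]
      exact hδm n _ _ (by linarith) hba (by linarith) (by linarith)
  have h3 : ‖∫ u in a..b, f u c‖ < ε / 3 := by
    refine (norm_integral_comp_le_of_bound (y := fun _ => c) hμ hμb (fun _ => hc) _ _).trans_lt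
      (hημ ?_)
    rw [Real.dist_eq, abs_lt]
    constructor <;> linarith
  rw [hsplit]
  refine norm_add₃_le.trans_lt ?_
  linarith

/-- The integral over `[q₁ + r, q₂ + r]` along the translate of a curve that is constant off
`[q₁, q₂]`, expressed through integrals along constant states. -/
theorem intervalIntegral_translate_eq {g : ℝ → Euc N → F} {m : ℝ → ℝ} {X : ℝ → Euc N} {j : ℕ}
    (hg : StronglyMeasurable (Function.uncurry g)) (hm : LocInt m)
    (hb : ∀ᵐ t : ℝ, ∀ x : Euc N, ‖x‖ ≤ (j : ℝ) → ‖g t x‖ ≤ m t)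
    (hX : Continuous X) (hXj : ∀ u, ‖X u‖ ≤ (j : ℝ)) {q₁ q₂ p₁ p₂ r : ℝ} {c₁ c₂ : Euc N}
    (hc₁ : ∀ u ≤ q₁, X u = c₁) (hc₂ : ∀ u, q₂ ≤ u → X u = c₂)
    (h₁ : p₁ ≤ q₁ + r) (h₂ : q₂ + r ≤ p₂) :
    ∫ s in q₁..q₂, g (s + r) (X s) =
      (∫ u in p₁..p₂, g u (X (u - r))) - (∫ u in p₁..(q₁ + r), g u c₁) +
        ∫ u in p₂..(q₂ + r), g u c₂ := by
  have hI : ∀ s t : ℝ, IntervalIntegrable (fun u => g u (X (u - r))) volume s t :=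
    intervalIntegrable_comp_of_bound (y := fun u => X (u - r)) hg hm hb
      (hX.comp (continuous_sub_right r)) (fun u => hXj _)
  have e : ∫ s in q₁..q₂, g (s + r) (X s) = ∫ u in (q₁ + r)..(q₂ + r), g u (X (u - r)) := by
    rw [← intervalIntegral.integral_comp_add_right (fun u => g u (X (u - r)))]
    simp
  have e₁ : ∫ u in p₁..(q₁ + r), g u c₁ = ∫ u in p₁..(q₁ + r), g u (X (u - r)) := by
    refine intervalIntegral.integral_congr fun u hu => ?_
    rw [uIcc_of_le h₁] at hu
    simp only [hc₁ (u - r) (by linarith [hu.2])]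
  have e₂ : ∫ u in p₂..(q₂ + r), g u c₂ = ∫ u in p₂..(q₂ + r), g u (X (u - r)) := by
    refine intervalIntegral.integral_congr fun u hu => ?_
    rw [uIcc_of_ge h₂] at hu
    simp only [hc₂ (u - r) (by linarith [hu.1])]
  rw [e, e₁, e₂, intervalIntegral.integral_interval_sub_left (hI _ _) (hI _ _),
    intervalIntegral.integral_add_adjacent_intervals (hI _ _) (hI _ _)]

end Aux

/-- joint sequential continuity of the translation map on a set
`E ⊆ WTC` with L¹_loc-equicontinuous m-bounds, for the `σ_Θ` convergence. -/
theorem stmt5 {N M : ℕ} (Θ : SuitableModuli) (E : Set (ℝ → Euc N → Euc M))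
    (hE : ∀ f ∈ E, IsWTC Θ f)
    (m : (ℝ → Euc N → Euc M) → ℕ → ℝ → ℝ)
    (hm_nonneg : ∀ f ∈ E, ∀ (j : ℕ) (t : ℝ), 0 ≤ m f j t)
    (hm_int : ∀ f ∈ E, ∀ j : ℕ, LocInt (m f j))
    (hm_bound : ∀ f ∈ E, ∀ j : ℕ, ∀ᵐ t : ℝ, ∀ x : Euc N, ‖x‖ ≤ (j:ℝ) → ‖f t x‖ ≤ m f j t)
    (hm_equi : ∀ j : ℕ, ∀ r > (0:ℝ), ∀ ε > (0:ℝ), ∃ δ > (0:ℝ), ∀ f ∈ E, ∀ s t : ℝ,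
      -r ≤ s → s ≤ t → t ≤ r → t - s < δ → ∫ u in Icc s t, m f j u < ε)
    (fs : ℕ → ℝ → Euc N → Euc M) (hfs : ∀ n, fs n ∈ E)
    (f : ℝ → Euc N → Euc M) (hf : IsWTC Θ f)
    (hconv : SigmaTendsto Θ fs f)
    (ts : ℕ → ℝ) (t : ℝ) (hts : Tendsto ts atTop (𝓝 t)) :
    SigmaTendsto Θ (fun n s x => fs n (s + ts n) x) (fun s x => f (s + t) x) := by
  intro j q₁ q₂ ε hε
  rcases lt_or_ge (q₂ : ℝ) q₁ with hq | hq
  · exact Eventually.of_forall fun n x _ => by simpa [Icc_eq_empty_of_lt hq] using hε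
  obtain ⟨p₁, hp₁⟩ := exists_rat_lt (min (q₁ : ℝ) (q₁ + t - 1))
  obtain ⟨p₂, hp₂⟩ := exists_rat_gt (max (q₂ : ℝ) (q₂ + t + 1))
  obtain ⟨hp₁q, hp₁t⟩ := lt_min_iff.1 hp₁
  obtain ⟨hp₂q, hp₂t⟩ := max_lt_iff.1 hp₂
  have hp : (p₁ : ℝ) ≤ p₂ := by linarith
  have hε4 : 0 < ε / 4 := by positivity
  obtain ⟨δ, hδ, hδf⟩ := hf.uniform j hp hε4
  obtain ⟨μ, hμ, hμb⟩ := hf.1.exists_bound_ball j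
  have hmeas : ∀ n, StronglyMeasurable (Function.uncurry (fs n)) := fun n => (hE _ (hfs n)).1.1
  have hside : ∀ (p : ℚ) (a : ℝ), ∀ᶠ n in atTop, ∀ c : Euc N, ‖c‖ ≤ (j : ℝ) →
      ‖(∫ u in (p : ℝ)..(a + ts n), fs n u c) - ∫ u in (p : ℝ)..(a + t), f u c‖ < ε / 4 := by
    intro p a
    refine hconv.intervalIntegral_const_moving hf.1 hmeas j (m := fun n => m (fs n) j)
      (fun n => hm_nonneg _ (hfs n) j) (fun n => hm_int _ (hfs n) j)
      (fun n => hm_bound _ (hfs n) j) ?_ p (hts.const_add a) hε4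
    intro r hr ε' hε'
    obtain ⟨d, hd, H⟩ := hm_equi j r hr ε' hε'
    exact ⟨d, hd, fun n => H _ (hfs n)⟩
  have hts0 : Tendsto (fun n => |ts n - t|) atTop (𝓝 0) := by
    simpa using (hts.sub_const t).abs
  have hθ : ∀ᶠ n in atTop, Θ.θ j q₁ q₂ |ts n - t| < δ := by
    have h0 := Θ.cont j q₁ q₂ 0 self_mem_Ici
    rw [ContinuousWithinAt, Θ.zero] at h0
    exact (h0.comp (tendsto_nhdsWithin_iff.2
      ⟨hts0, Eventually.of_forall fun n => mem_Ici.2 (abs_nonneg _)⟩)).eventually_lt_const hδ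
  filter_upwards [hconv j p₁ p₂ (ε / 4) hε4, hside p₁ q₁, hside p₂ q₂, hθ,
    hts0.eventually_lt_const one_pos] with n hn hl hr hθn htn x hx
  obtain ⟨X, hX, hXj, hXθ, hXx, hX₁, hX₂⟩ := hx.exists_extension hq
  have htn' := abs_lt.1 htn
  have hK : ∀ r, inK Θ j p₁ p₂ fun u => X (u - r) :=
    inK_of_forall hX hXj hXθ (by exact_mod_cast hp₁q.le) (by exact_mod_cast hp₂q.le)
  have hXc : ∀ r, Continuous fun u => X (u - r) := fun r => hX.comp (continuous_sub_right r)
  have hI : ∀ r a b, IntervalIntegrable (fun u => fs n u (X (u - r))) volume a b := fun r =>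
    intervalIntegrable_comp_of_bound (hmeas n) (hm_int _ (hfs n) j) (hm_bound _ (hfs n) j)
      (hXc r) (fun u => hXj _)
  have hJ : ∀ r a b, IntervalIntegrable (fun u => f u (X (u - r))) volume a b := fun r =>
    intervalIntegrable_comp_of_bound hf.1.1 hμ hμb (hXc r) (fun u => hXj _)
  have e : ∫ s in Icc (q₁ : ℝ) q₂, (fs n (s + ts n) (x s) - f (s + t) (x s)) =
      (∫ s in (q₁ : ℝ)..q₂, fs n (s + ts n) (X s)) - ∫ s in (q₁ : ℝ)..q₂, f (s + t) (X s) := by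
    rw [← intervalIntegral.integral_sub, ← setIntegral_Icc_eq_intervalIntegral _ hq]
    · refine setIntegral_congr_fun measurableSet_Icc fun s hs => ?_
      simp only [hXx s hs]
    · simpa using (hI (ts n) (q₁ + ts n) (q₂ + ts n)).comp_add_right (ts n)
    · simpa using (hJ t (q₁ + t) (q₂ + t)).comp_add_right t
  have hmid := hn _ (hK (ts n))
  rw [setIntegral_Icc_eq_intervalIntegral _ hp,
    intervalIntegral.integral_sub (hI _ _ _) (hJ _ _ _)] at hmid
  have hunif := hδf _ _ (hK (ts n)) (hK t) fun u _ => by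
    refine (hXθ _ _).trans_lt ?_
    rwa [sub_sub_sub_cancel_left, abs_sub_comm]
  rw [setIntegral_Icc_eq_intervalIntegral _ hp, setIntegral_Icc_eq_intervalIntegral _ hp] at hunif
  have hl' := hl (x q₁) (hx.2.1 _ ⟨le_rfl, hq⟩)
  have hr' := hr (x q₂) (hx.2.1 _ ⟨hq, le_rfl⟩)
  rw [e, intervalIntegral_translate_eq (hmeas n) (hm_int _ (hfs n) j) (hm_bound _ (hfs n) j)
      hX hXj hX₁ hX₂ (p₁ := p₁) (p₂ := p₂) (by linarith) (by linarith),
    intervalIntegral_translate_eq hf.1.1 hμ hμb hX hXj hX₁ hX₂ (p₁ := p₁) (p₂ := p₂)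
      (by linarith) (by linarith)]
  have key : ∀ A B C D G L R : Euc M, ‖A - B‖ < ε / 4 → ‖B - C‖ < ε / 4 → ‖D - G‖ < ε / 4 →
      ‖L - R‖ < ε / 4 → ‖(A - D + L) - (C - G + R)‖ < ε := by
    intro A B C D G L R h1 h2 h3 h4
    have : (A - D + L) - (C - G + R) = ((A - B) + (B - C)) + (-(D - G) + (L - R)) := by abel
    rw [this]
    have k1 := norm_add_le (A - B) (B - C)
    have k2 := norm_add_le (-(D - G)) (L - R)
    rw [norm_neg] at k2
    linarith [norm_add_le ((A - B) + (B - C)) (-(D - G) + (L - R))]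
  exact key _ _ _ _ _ _ _ hmid hunif hl' hr'
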